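/- arXiv:1301.1403 — 2 statements merged into one kernel-verified Lean document; each statement's English description precedes it below -/
import Mathlib

section
/- For every α > 0, β ∈ ℝ, and nonnegative integers n, m, the generalized Hermite functions satisfy the orthogonality relation ∫_ℝ H_n^{α,β}(x) H_m^{α,β}(x) dx = (√π/α) δ_{nm}, where δ_{nm} is the Kronecker delta. -/
open MeasureTheory Real Filter

/-- Physical Hermite polynomials: `𝓗 n x = (-1)^n e^{x²} (d/dx)^n e^{-x²}`. -/
noncomputable def physHermite (n : ℕ) : ℝ → ℝ :=
  fun x => (-1 : ℝ)^n * Real.exp (x^2) * iteratedDeriv n (fun y => Real.exp (-y^2)) x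

/-- Generalized Hermite functions with scaling factor `α` and translating factor `β`. -/
noncomputable def genHermite (α β : ℝ) (n : ℕ) : ℝ → ℝ :=
  fun x => (1 / Real.sqrt (2^n * n.factorial)) * physHermite n (α*(x-β)) *
    Real.exp (-α^2*(x-β)^2/2)

open Polynomial in
/-- The physicists' Hermite polynomials as elements of `ℝ[X]`. -/
noncomputable def physHermitePoly : ℕ → ℝ[X]
  | 0 => 1
  | n + 1 => 2 * X * physHermitePoly n - derivative (physHermitePoly n)

open Polynomial in
theorem derivative_physHermitePoly_succ (n : ℕ) :
    derivative (physHermitePoly (n + 1)) = C (2 * (n + 1 : ℝ)) * physHermitePoly n := by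
  induction n with
  | zero =>
    simp only [physHermitePoly, derivative_one, mul_one, sub_zero, derivative_mul, derivative_X,
      derivative_ofNat, zero_mul, zero_add, Nat.cast_zero]
    rfl
  | succ n ih =>
    have hC : (C (2 : ℝ) : ℝ[X]) = 2 := rfl
    rw [physHermitePoly, derivative_sub, ih]
    simp only [derivative_mul, derivative_X, derivative_ofNat, derivative_C, ih]
    conv_rhs => rw [physHermitePoly]
    conv_lhs => rw [physHermitePoly]
    simp only [map_mul, map_add, hC, map_natCast, map_one]
    push_cast
    ring

open Polynomial in
theorem hasDerivAt_eval_mul_gaussian (p : ℝ[X]) (x : ℝ) :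
    HasDerivAt (fun y => p.eval y * Real.exp (-y ^ 2))
      (-((2 * X * p - derivative p).eval x * Real.exp (-x ^ 2))) x := by
  have hexp : HasDerivAt (fun y : ℝ => Real.exp (-y ^ 2))
      (Real.exp (-x ^ 2) * -(2 * x)) x := by
    simpa using ((hasDerivAt_pow 2 x).neg).exp
  refine ((p.hasDerivAt x).mul hexp).congr_deriv ?_
  simp only [eval_sub, eval_mul, eval_X, eval_ofNat]
  ring

theorem iteratedDeriv_gaussian_eq_physHermitePoly (n : ℕ) :
    iteratedDeriv n (fun y : ℝ => Real.exp (-y ^ 2)) =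
      fun x => (-1 : ℝ) ^ n * ((physHermitePoly n).eval x * Real.exp (-x ^ 2)) := by
  induction n with
  | zero => simp [physHermitePoly]
  | succ n ih =>
    funext x
    rw [iteratedDeriv_succ, ih,
      ((hasDerivAt_eval_mul_gaussian (physHermitePoly n) x).const_mul _).deriv, physHermitePoly]
    ring

theorem physHermite_eq_eval (n : ℕ) (x : ℝ) :
    physHermite n x = (physHermitePoly n).eval x := by
  have h1 : ((-1 : ℝ) ^ n) * (-1) ^ n = 1 := by rw [← mul_pow]; simp
  have h2 : Real.exp (x ^ 2) * Real.exp (-x ^ 2) = 1 := by rw [← Real.exp_add]; simp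
  rw [physHermite, iteratedDeriv_gaussian_eq_physHermitePoly]
  linear_combination (physHermitePoly n).eval x * (h1 * Real.exp (x ^ 2) * Real.exp (-x ^ 2) + h2)

open Polynomial in
theorem integrable_eval_mul_gaussian (p : ℝ[X]) :
    Integrable fun x => p.eval x * Real.exp (-x ^ 2) := by
  induction p using Polynomial.induction_on' with
  | add p q hp hq =>
    simp only [eval_add, add_mul]
    exact hp.add hq
  | monomial k a =>
    have h : Integrable fun x : ℝ => x ^ (k : ℝ) * Real.exp (-1 * x ^ 2) :=
      integrable_rpow_mul_exp_neg_mul_sq one_pos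
        (neg_one_lt_zero.trans_le (Nat.cast_nonneg k))
    simpa only [Real.rpow_natCast, neg_one_mul, eval_monomial, mul_assoc] using h.const_mul a

open Polynomial in
theorem integral_eval_mul_physHermitePoly_succ (p : ℝ[X]) (n : ℕ) :
    ∫ x, p.eval x * ((physHermitePoly (n + 1)).eval x * Real.exp (-x ^ 2)) =
      ∫ x, (derivative p).eval x * ((physHermitePoly n).eval x * Real.exp (-x ^ 2)) := by
  have hint (q r : ℝ[X]) : Integrable fun x => q.eval x * (r.eval x * Real.exp (-x ^ 2)) := by
    simpa only [eval_mul, mul_assoc] using integrable_eval_mul_gaussian (q * r)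
  have h := integral_mul_deriv_eq_deriv_mul_of_integrable
    (fun x _ => p.hasDerivAt x)
    (fun x _ => hasDerivAt_eval_mul_gaussian (physHermitePoly n) x)
    (by
      simp only [Pi.mul_def, mul_neg]
      exact (hint p (physHermitePoly (n + 1))).neg)
    (hint _ _) (hint _ _)
  simp only [mul_neg, integral_neg, neg_inj] at h
  exact h

theorem integral_physHermitePoly_mul (n m : ℕ) :
    ∫ x, (physHermitePoly n).eval x * ((physHermitePoly m).eval x * Real.exp (-x ^ 2)) =
      if n = m then 2 ^ n * n.factorial * √π else 0 := by
  induction n generalizing m with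
  | zero =>
    cases m with
    | zero => simpa [physHermitePoly] using integral_gaussian 1
    | succ m =>
      rw [integral_eval_mul_physHermitePoly_succ]
      simp [physHermitePoly]
  | succ n ih =>
    cases m with
    | zero =>
      simp_rw [mul_left_comm ((physHermitePoly (n + 1)).eval _)]
      rw [integral_eval_mul_physHermitePoly_succ]
      simp [physHermitePoly]
    | succ m =>
      rw [integral_eval_mul_physHermitePoly_succ, derivative_physHermitePoly_succ]
      simp only [Polynomial.eval_mul, Polynomial.eval_C, mul_assoc (2 * ((n : ℝ) + 1))]
      rw [integral_const_mul, ih]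
      simp only [Nat.add_right_cancel_iff, Nat.factorial_succ]
      split_ifs
      · push_cast
        ring
      · simp

/-- Orthogonality of the generalized Hermite functions:
`∫ H_n^{α,β} H_m^{α,β} = (√π/α) δ_{nm}`. -/
theorem stmt0 (α β : ℝ) (hα : 0 < α) (n m : ℕ) :
    ∫ x : ℝ, genHermite α β n x * genHermite α β m x =
      (Real.sqrt Real.pi / α) * (if n = m then 1 else 0) := by
  let f : ℝ → ℝ := fun y =>
    (physHermitePoly n).eval y * ((physHermitePoly m).eval y * Real.exp (-y ^ 2))
  have hf (x : ℝ) : genHermite α β n x * genHermite α β m x =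
      1 / √(2 ^ n * n.factorial) * (1 / √(2 ^ m * m.factorial)) * f (α * (x - β)) := by
    have hexp : Real.exp (-(α * (x - β)) ^ 2) =
        Real.exp (-α ^ 2 * (x - β) ^ 2 / 2) * Real.exp (-α ^ 2 * (x - β) ^ 2 / 2) := by
      rw [← Real.exp_add]
      ring_nf
    simp only [genHermite, physHermite_eq_eval, f, hexp]
    ring
  simp_rw [hf]
  rw [integral_const_mul, integral_sub_right_eq_self (fun x => f (α * x)) β,
    Measure.integral_comp_mul_left, integral_physHermitePoly_mul, abs_of_pos (inv_pos.2 hα),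
    smul_eq_mul]
  split_ifs with h
  · subst h
    have hpos : (0 : ℝ) < 2 ^ n * n.factorial := by positivity
    have hsq := Real.mul_self_sqrt hpos.le
    have hne := (Real.sqrt_pos.2 hpos).ne'
    field_simp
    rw [sq, hsq]
  · simp
end

section
/- (Equivalence of the frozen robust DMZ equation and the forward Kolmogorov equation, 1D case) Let f, g, h, Q, S be smooth real-valued functions of (x,t) with S(t) > 0, let τ_{i−1} < τ_i, let y_{τ_{i−1}} ∈ ℝ be a fixed constant, and define L(v) = (1/2) ∂²_x[(g² Q) v] − ∂_x(f v). For τ_{i−1} ≤ t < τ_i, a smooth function ρ_i(x,t) satisfies ∂_t ρ_i + ∂_t(h S^{−1}) y_{τ_{i−1}} ρ_i = exp(−h S^{−1} y_{τ_{i−1}}) [L − (1/2) h² S^{−1}]( exp(h S^{−1} y_{τ_{i−1}}) ρ_i ) if and only if u_i(x,t) = exp(h(x,t) S^{−1}(t) y_{τ_{i−1}}) ρ_i(x,t) satisfies the forward Kolmogorov equation ∂_t u_i = (L − (1/2) h² S^{−1}) u_i on [τ_{i−1}, τ_i). -/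
open MeasureTheory Real Filter

/-- The operator `L(v) = (1/2) ∂²_x[(g² Q) v] − ∂_x(f v)` (1D case), acting on a
function `v` of `x` at a fixed time `t`. -/
noncomputable def Lop (f g : ℝ → ℝ → ℝ) (Q : ℝ → ℝ) (t : ℝ) (v : ℝ → ℝ) (x : ℝ) : ℝ :=
  (1/2) * iteratedDeriv 2 (fun y => (g y t)^2 * Q t * v y) x
    - deriv (fun y => f y t * v y) x

lemma differentiableAt_snd_of_contDiff {φ : ℝ → ℝ → ℝ}
    (hφ : ContDiff ℝ (⊤ : ℕ∞) (Function.uncurry φ)) (x t : ℝ) :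
    DifferentiableAt ℝ (fun s => φ x s) t :=
  ((hφ.differentiable (by simp)) (x, t)).comp t
    (DifferentiableAt.prodMk (differentiableAt_const x) differentiableAt_id)

/-- The integrating-factor product rule. -/
lemma deriv_exp_mul_mul {a r : ℝ → ℝ} {t : ℝ} (ha : DifferentiableAt ℝ a t)
    (hr : DifferentiableAt ℝ r t) (c : ℝ) :
    deriv (fun s => Real.exp (a s * c) * r s) t =
      Real.exp (a t * c) * (deriv r t + deriv a t * c * r t) := by
  refine ((ha.hasDerivAt.mul_const c).exp.mul hr.hasDerivAt).deriv.trans ?_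
  ring

/-- Equivalence of the frozen robust DMZ equation and the forward Kolmogorov
equation (1D case): for smooth `f, g, h, Q, S` with `S > 0` and a fixed frozen
observation `yObs = y_{τ_{i−1}}`, a smooth `ρᵢ` satisfies
`∂_t ρᵢ + ∂_t(h S⁻¹) yObs ρᵢ = e^{−h S⁻¹ yObs} [L − (1/2) h² S⁻¹](e^{h S⁻¹ yObs} ρᵢ)`
on `[τ_{i−1}, τ_i)` if and only if `uᵢ(x,t) = e^{h(x,t) S(t)⁻¹ yObs} ρᵢ(x,t)`
satisfies `∂_t uᵢ = (L − (1/2) h² S⁻¹) uᵢ` on `[τ_{i−1}, τ_i)`. -/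
theorem stmt19 (f g h : ℝ → ℝ → ℝ) (Q S : ℝ → ℝ)
    (hf : ContDiff ℝ (⊤ : ℕ∞) (Function.uncurry f)) (hg : ContDiff ℝ (⊤ : ℕ∞) (Function.uncurry g))
    (hh : ContDiff ℝ (⊤ : ℕ∞) (Function.uncurry h))
    (hQ : ContDiff ℝ (⊤ : ℕ∞) Q) (hS : ContDiff ℝ (⊤ : ℕ∞) S) (hSpos : ∀ t : ℝ, 0 < S t)
    (τ₀ τ₁ : ℝ) (hτ : τ₀ < τ₁) (yObs : ℝ)
    (ρ : ℝ → ℝ → ℝ) (hρ : ContDiff ℝ (⊤ : ℕ∞) (Function.uncurry ρ)) :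
    (∀ x t : ℝ, t ∈ Set.Ico τ₀ τ₁ →
      deriv (fun s => ρ x s) t
          + deriv (fun s => h x s * (S s)⁻¹) t * yObs * ρ x t =
        Real.exp (-(h x t * (S t)⁻¹ * yObs)) *
          (Lop f g Q t (fun y => Real.exp (h y t * (S t)⁻¹ * yObs) * ρ y t) x
            - (1/2) * (h x t)^2 * (S t)⁻¹ *
              (Real.exp (h x t * (S t)⁻¹ * yObs) * ρ x t))) ↔
    (∀ x t : ℝ, t ∈ Set.Ico τ₀ τ₁ →
      deriv (fun s => Real.exp (h x s * (S s)⁻¹ * yObs) * ρ x s) t =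
        Lop f g Q t (fun y => Real.exp (h y t * (S t)⁻¹ * yObs) * ρ y t) x
          - (1/2) * (h x t)^2 * (S t)⁻¹ *
            (Real.exp (h x t * (S t)⁻¹ * yObs) * ρ x t)) := by
  refine forall_congr' fun x => forall_congr' fun t => imp_congr_right fun _ => ?_
  have hρx : DifferentiableAt ℝ (fun s => ρ x s) t := differentiableAt_snd_of_contDiff hρ x t
  have hhS : DifferentiableAt ℝ (fun s => h x s * (S s)⁻¹) t :=
    (differentiableAt_snd_of_contDiff hh x t).mul
      (((hS.differentiable (by simp)) t).inv (hSpos t).ne')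
  rw [deriv_exp_mul_mul hhS hρx, Real.exp_neg, eq_inv_mul_iff_mul_eq₀ (Real.exp_ne_zero _)]
end
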